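/- arXiv:2103.02474 — 2 statements merged into one kernel-verified Lean document; each statement's English description precedes it below -/
import Mathlib

section
/- Let a ≥ 0, γ ≥ 1, and γ < b < 2γ. Then there exists C > 0 such that for any Schwartz function f on ℝ², ∫_{ℝ²} ‖δ_α f − α·∇f‖^{2γ}_{Ḣ^a} |α|^{−2−2b} dα ≤ C ‖f‖^{2γ}_{Ḣ^{a+b/γ}}, where δ_α f(x) = f(x) − f(x−α). -/
open MeasureTheory FourierTransform

/-- Square of the homogeneous Sobolev norm `‖g‖²_{Ḣ^s}` on `ℝ²`. -/
noncomputable def HsqNorm (s : ℝ) (g : EuclideanSpace ℝ (Fin 2) → ℂ) : ℝ :=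
  ∫ ξ : EuclideanSpace ℝ (Fin 2), ‖ξ‖ ^ (2 * s) * ‖𝓕 g ξ‖ ^ 2

local notation "Plane" => EuclideanSpace ℝ (Fin 2)

theorem HsqNorm_nonneg (s : ℝ) (g : Plane → ℂ) : 0 ≤ HsqNorm s g :=
  integral_nonneg fun ξ => by positivity

/-- The Fourier symbol of `f ↦ δ_α f - α · ∇f`. -/
theorem fourier_sub_translate_sub_fderiv (f : SchwartzMap Plane ℂ) (α ξ : Plane) :
    𝓕 (fun x => f x - f (x - α) - fderiv ℝ (⇑f) x α) ξ =
      (1 - Complex.exp (-((2 * Real.pi * inner ℝ α ξ : ℝ) * Complex.I)) -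
        (2 * Real.pi * inner ℝ α ξ : ℝ) * Complex.I) * 𝓕 (⇑f) ξ := by
  have key : ∀ g : Plane → ℂ, Integrable g →
      Integrable (fun v => Real.fourierChar (-inner ℝ v ξ) • g v) := fun g hg =>
    (Real.fourierIntegral_convergent_iff (μ := volume) ξ).2 hg
  have hf : Integrable (⇑f) := f.integrable
  have hd : Integrable (fun x => fderiv ℝ (⇑f) x α) :=
    (LineDeriv.lineDerivOp α f).integrable.congr
      (.of_forall fun x => SchwartzMap.lineDerivOp_apply_eq_fderiv α f x)
  have ht : Integrable (fun x => f (x - α)) := hf.comp_sub_right α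
  have h1 : 𝓕 (fun x => f x - f (x - α) - fderiv ℝ (⇑f) x α) ξ =
      𝓕 (⇑f) ξ - 𝓕 (fun x => f (x - α)) ξ - 𝓕 (fun x => fderiv ℝ (⇑f) x α) ξ := by
    simp only [Real.fourier_eq, smul_sub]
    have h := integral_sub ((key _ hf).sub (key _ ht)) (key _ hd)
    simp only [Pi.sub_apply] at h
    rw [h, integral_sub (key _ hf) (key _ ht)]
  have h2 : 𝓕 (fun x => f (x - α)) ξ =
      Complex.exp (-((2 * Real.pi * inner ℝ α ξ : ℝ) * Complex.I)) * 𝓕 (⇑f) ξ := by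
    have := congrFun (VectorFourier.fourierIntegral_comp_add_right Real.fourierChar volume
      (innerₗ Plane) (⇑f) (-α)) ξ
    simp only [← sub_eq_add_neg] at this
    refine this.trans ?_
    rw [Circle.smul_def, Real.fourierChar_apply, smul_eq_mul]
    congr 2
    simp
  have h3 : 𝓕 (fun x => fderiv ℝ (⇑f) x α) ξ =
      (2 * Real.pi * inner ℝ α ξ : ℝ) * Complex.I * 𝓕 (⇑f) ξ := by
    have h := congrArg (fun g : SchwartzMap Plane ℂ => g ξ) (SchwartzMap.fourier_lineDerivOp_eq f α)
    have e : (⇑(LineDeriv.lineDerivOp α f) : Plane → ℂ) = fun x => fderiv ℝ (⇑f) x α :=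
      funext fun x => SchwartzMap.lineDerivOp_apply_eq_fderiv α f x
    simp only [SchwartzMap.fourier_coe, e] at h
    rw [h, smul_apply,
      SchwartzMap.smulLeftCLM_apply_apply (by fun_prop)]
    simp [SchwartzMap.fourier_coe, real_inner_comm]
    ring
  rw [h1, h2, h3]; ring

theorem norm_one_sub_exp_sub_le (θ : ℝ) :
    ‖1 - Complex.exp (-(θ * Complex.I)) - θ * Complex.I‖ ≤ 2 * |θ| * min 1 |θ| := by
  have hn : ‖-((θ : ℂ) * Complex.I)‖ = |θ| := by simp
  have hneg : 1 - Complex.exp (-(θ * Complex.I)) - θ * Complex.I =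
      -(Complex.exp (-(θ * Complex.I)) - 1 - -(θ * Complex.I)) := by ring
  rw [hneg, norm_neg]
  rcases le_total |θ| 1 with h | h
  · rw [min_eq_right h]
    have := Complex.norm_exp_sub_one_sub_id_le (x := -((θ : ℂ) * Complex.I)) (hn ▸ h)
    rw [hn] at this
    nlinarith [abs_nonneg θ]
  · rw [min_eq_left h]
    have h1 := Real.norm_exp_I_mul_ofReal_sub_one_le (x := -θ)
    have e : Complex.I * ((-θ : ℝ) : ℂ) = -(θ * Complex.I) := by push_cast; ring
    rw [e, Real.norm_eq_abs, abs_neg] at h1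
    refine (norm_sub_le _ _).trans ?_
    rw [hn]; linarith

theorem norm_fourier_sub_translate_sub_fderiv_le (f : SchwartzMap Plane ℂ) (α ξ : Plane) :
    ‖𝓕 (fun x => f x - f (x - α) - fderiv ℝ (⇑f) x α) ξ‖ ≤
      2 * (2 * Real.pi * ‖ξ‖ * ‖α‖) * min 1 (2 * Real.pi * ‖ξ‖ * ‖α‖) * ‖𝓕 (⇑f) ξ‖ := by
  rw [fourier_sub_translate_sub_fderiv, norm_mul]
  have h : |2 * Real.pi * inner ℝ α ξ| ≤ 2 * Real.pi * ‖ξ‖ * ‖α‖ := by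
    rw [abs_mul, abs_of_pos Real.two_pi_pos, mul_assoc _ ‖ξ‖, mul_comm ‖ξ‖]
    gcongr
    exact abs_real_inner_le_norm α ξ
  gcongr
  exact (norm_one_sub_exp_sub_le _).trans (by gcongr)

theorem integrable_radial_kernel {γ b : ℝ} (hγb : γ < b) (hb : b < 2 * γ) :
    Integrable (fun β : Plane =>
      (2 * ‖β‖ * min 1 ‖β‖) ^ (2 * γ) * ‖β‖ ^ (-(2 + 2 * b))) := by
  refine (integrable_fun_norm_addHaar (μ := (volume : Measure Plane))
    (f := fun y : ℝ => (2 * y * min 1 y) ^ (2 * γ) * y ^ (-(2 + 2 * b)))).2 ?_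
  simp only [finrank_euclideanSpace, Fintype.card_fin, smul_eq_mul]
  rw [← Set.Ioc_union_Ioi_eq_Ioi zero_le_one]
  refine IntegrableOn.union ?_ ?_
  · have : IntegrableOn (fun y : ℝ => 2 ^ (2 * γ) * y ^ (4 * γ - 2 * b - 1)) (Set.Ioc 0 1) :=
      (((intervalIntegral.intervalIntegrable_rpow' (by linarith)).1).const_mul _)
    refine this.congr_fun (fun y hy => ?_) measurableSet_Ioc
    have hy0 : 0 < y := hy.1
    simp only [min_eq_right hy.2]
    have : y ^ (2 - 1) = y ^ (1 : ℝ) := by simp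
    rw [this, mul_assoc 2 y y, Real.mul_rpow (by positivity) (by positivity),
      Real.mul_rpow hy0.le hy0.le, mul_assoc, mul_left_comm]
    congr 1
    rw [← Real.rpow_add hy0, ← Real.rpow_add hy0, ← Real.rpow_add hy0]
    congr 1; ring
  · have : IntegrableOn (fun y : ℝ => 2 ^ (2 * γ) * y ^ (2 * γ - 2 * b - 1)) (Set.Ioi 1) :=
      (integrableOn_Ioi_rpow_of_lt (by linarith) one_pos).const_mul _
    refine this.congr_fun (fun y hy => ?_) measurableSet_Ioi
    have hy1 : 1 < y := hy
    have hy0 : 0 < y := one_pos.trans hy1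
    simp only [min_eq_left hy1.le]
    have : y ^ (2 - 1) = y ^ (1 : ℝ) := by simp
    rw [this, mul_one, Real.mul_rpow (by positivity) (by positivity), mul_assoc, mul_left_comm]
    congr 1
    rw [← Real.rpow_add hy0, ← Real.rpow_add hy0]
    congr 1; ring

theorem lintegral_radial_kernel_dilate {γ b : ℝ} (hγb : γ < b) (hb : b < 2 * γ)
    {R : ℝ} (hR : 0 < R) :
    ∫⁻ α : Plane, ENNReal.ofReal
        ((2 * (R * ‖α‖) * min 1 (R * ‖α‖)) ^ (2 * γ) * ‖α‖ ^ (-(2 + 2 * b))) =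
      ENNReal.ofReal (R ^ (2 * b) * ∫ β : Plane,
        (2 * ‖β‖ * min 1 ‖β‖) ^ (2 * γ) * ‖β‖ ^ (-(2 + 2 * b))) := by
  set W : Plane → ℝ := fun β =>
    (2 * ‖β‖ * min 1 ‖β‖) ^ (2 * γ) * ‖β‖ ^ (-(2 + 2 * b)) with hW
  have hint : Integrable W := integrable_radial_kernel hγb hb
  have e : ∀ α : Plane, (2 * (R * ‖α‖) * min 1 (R * ‖α‖)) ^ (2 * γ) * ‖α‖ ^ (-(2 + 2 * b)) =
      R ^ (2 + 2 * b) * W (R • α) := by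
    intro α
    simp only [hW, norm_smul, Real.norm_eq_abs, abs_of_pos hR]
    rw [Real.mul_rpow hR.le (norm_nonneg α) (z := -(2 + 2 * b)), Real.rpow_neg hR.le]
    field_simp
  simp_rw [e]
  rw [← ofReal_integral_eq_lintegral_ofReal ((hint.comp_smul hR.ne').const_mul _)
    (.of_forall fun α => by simp only [hW, Pi.zero_apply]; positivity),
    integral_const_mul, Measure.integral_comp_smul, smul_eq_mul, ← mul_assoc]
  congr 2
  rw [finrank_euclideanSpace, Fintype.card_fin, abs_of_pos (by positivity), Real.rpow_add hR,
    Real.rpow_two]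
  field_simp

theorem lintegral_rpow_le_mul_measure_univ_rpow {Ω : Type*} [MeasurableSpace Ω] {μ : Measure Ω}
    {h : Ω → ENNReal} (hh : AEMeasurable h μ) {γ : ℝ} (hγ : 1 ≤ γ) :
    (∫⁻ x, h x ∂μ) ^ γ ≤ (∫⁻ x, h x ^ γ ∂μ) * μ Set.univ ^ (γ - 1) := by
  have hγ0 : 0 < γ := by linarith
  have := eLpNorm'_le_eLpNorm'_mul_rpow_measure_univ one_pos hγ hh.aestronglyMeasurable
  simp only [eLpNorm', enorm_eq_self, ENNReal.rpow_one, div_one] at this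
  refine (ENNReal.rpow_le_rpow this hγ0.le).trans_eq ?_
  rw [ENNReal.mul_rpow_of_nonneg _ _ hγ0.le, ← ENNReal.rpow_mul, ← ENNReal.rpow_mul]
  congr 2
  · simp [hγ0.ne']
  · field_simp

theorem integrable_norm_rpow_mul_norm_fourier_sq (f : SchwartzMap Plane ℂ) {s : ℝ} (hs : 0 ≤ s) :
    Integrable (fun ξ : Plane => ‖ξ‖ ^ (2 * s) * ‖𝓕 (⇑f) ξ‖ ^ 2) := by
  rw [← SchwartzMap.fourier_coe]
  set F := 𝓕 f
  obtain ⟨n, hn⟩ := exists_nat_ge (2 * s)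
  obtain ⟨B, hB⟩ := F.decay 0 0
  have hB : ∀ x, ‖F x‖ ≤ B := by simpa using hB.2
  have hi := ((F.integrable_pow_mul volume 0).add (F.integrable_pow_mul volume n)).mul_const B
  refine hi.mono' ?_ (.of_forall fun ξ => ?_)
  · exact ((continuous_norm.rpow_const fun _ => Or.inr (by positivity)).mul
      (F.continuous.norm.pow 2)).aestronglyMeasurable
  · have h1 : ‖ξ‖ ^ (2 * s) ≤ 1 + ‖ξ‖ ^ n := by
      rcases le_total ‖ξ‖ 1 with h | h
      · exact (Real.rpow_le_one (norm_nonneg _) h (by positivity)).trans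
          (le_add_of_nonneg_right (by positivity))
      · refine (Real.rpow_le_rpow_of_exponent_le h hn).trans ?_
        rw [Real.rpow_natCast]; linarith
    rw [Real.norm_of_nonneg (by positivity)]
    simp only [Pi.add_apply, pow_zero, one_mul]
    calc ‖ξ‖ ^ (2 * s) * ‖F ξ‖ ^ 2 ≤ (1 + ‖ξ‖ ^ n) * (‖F ξ‖ * B) := by
          rw [sq]; gcongr; exact hB ξ
      _ = _ := by ring

theorem enorm_HsqNorm_sub_translate_sub_fderiv_le (f : SchwartzMap Plane ℂ) (a c : ℝ) (α : Plane) :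
    ‖HsqNorm a (fun x => f x - f (x - α) - fderiv ℝ (⇑f) x α)‖ₑ ≤
      ∫⁻ ξ : Plane, ENNReal.ofReal (‖ξ‖ ^ (-(2 * c)) *
          (2 * (2 * Real.pi * ‖ξ‖ * ‖α‖) * min 1 (2 * Real.pi * ‖ξ‖ * ‖α‖)) ^ 2)
        ∂(volume.withDensity fun ξ : Plane =>
          ENNReal.ofReal (‖ξ‖ ^ (2 * (a + c)) * ‖𝓕 (⇑f) ξ‖ ^ 2)) := by
  have hF : Continuous (𝓕 (⇑f)) := (𝓕 f).continuous
  rw [lintegral_withDensity_eq_lintegral_mul _ (by fun_prop) (by fun_prop)]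
  unfold HsqNorm
  refine (enorm_integral_le_lintegral_enorm _).trans (lintegral_mono fun ξ => ?_)
  rw [Real.enorm_of_nonneg (by positivity), Pi.mul_apply, ← ENNReal.ofReal_mul (by positivity)]
  refine ENNReal.ofReal_le_ofReal ?_
  rcases eq_or_ne ξ 0 with rfl | hξ
  · have := norm_fourier_sub_translate_sub_fderiv_le f α 0
    simp only [norm_zero, mul_zero, zero_mul] at this
    rw [le_antisymm this (norm_nonneg _)]
    simp
  · have hξ0 : 0 < ‖ξ‖ := norm_pos_iff.2 hξ
    calc _ ≤ ‖ξ‖ ^ (2 * a) * (2 * (2 * Real.pi * ‖ξ‖ * ‖α‖) *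
            min 1 (2 * Real.pi * ‖ξ‖ * ‖α‖) * ‖𝓕 (⇑f) ξ‖) ^ 2 := by
          gcongr; exact norm_fourier_sub_translate_sub_fderiv_le f α ξ
      _ = _ := by
          have : ‖ξ‖ ^ (2 * a) = ‖ξ‖ ^ (2 * (a + c)) * ‖ξ‖ ^ (-(2 * c)) := by
            rw [← Real.rpow_add hξ0]; congr 1; ring
          rw [this]; ring

theorem lintegral_weighted_kernel_le {γ b : ℝ} (hγ : 0 < γ) (hγb : γ < b) (hb : b < 2 * γ)
    (ξ : Plane) :
    ∫⁻ α : Plane, ENNReal.ofReal (‖ξ‖ ^ (-(2 * (b / γ))) *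
          (2 * (2 * Real.pi * ‖ξ‖ * ‖α‖) * min 1 (2 * Real.pi * ‖ξ‖ * ‖α‖)) ^ 2) ^ γ *
        ENNReal.ofReal (‖α‖ ^ (-(2 + 2 * b))) ≤
      ENNReal.ofReal ((2 * Real.pi) ^ (2 * b) * ∫ β : Plane,
        (2 * ‖β‖ * min 1 ‖β‖) ^ (2 * γ) * ‖β‖ ^ (-(2 + 2 * b))) := by
  rcases eq_or_ne ξ 0 with rfl | hξ
  · simp [hγ]
  have hξ0 : 0 < ‖ξ‖ := norm_pos_iff.2 hξ
  have e : ∀ α : Plane, ENNReal.ofReal (‖ξ‖ ^ (-(2 * (b / γ))) *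
          (2 * (2 * Real.pi * ‖ξ‖ * ‖α‖) * min 1 (2 * Real.pi * ‖ξ‖ * ‖α‖)) ^ 2) ^ γ *
        ENNReal.ofReal (‖α‖ ^ (-(2 + 2 * b))) = ENNReal.ofReal (‖ξ‖ ^ (-(2 * b))) *
        ENNReal.ofReal ((2 * (2 * Real.pi * ‖ξ‖ * ‖α‖) *
          min 1 (2 * Real.pi * ‖ξ‖ * ‖α‖)) ^ (2 * γ) * ‖α‖ ^ (-(2 + 2 * b))) := by
    intro α
    have hk : 0 ≤ 2 * (2 * Real.pi * ‖ξ‖ * ‖α‖) * min 1 (2 * Real.pi * ‖ξ‖ * ‖α‖) := by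
      positivity
    rw [ENNReal.ofReal_rpow_of_nonneg (by positivity) hγ.le, ← ENNReal.ofReal_mul (by positivity),
      ← ENNReal.ofReal_mul (by positivity), Real.mul_rpow (by positivity) (by positivity),
      ← Real.rpow_mul hξ0.le, ← Real.rpow_two, ← Real.rpow_mul hk, mul_assoc]
    congr 3
    field_simp
  simp_rw [e]
  rw [lintegral_const_mul' _ _ ENNReal.ofReal_ne_top,
    lintegral_radial_kernel_dilate hγb hb (by positivity), ← ENNReal.ofReal_mul (by positivity)]
  refine ENNReal.ofReal_le_ofReal (le_of_eq ?_)
  rw [Real.mul_rpow (by positivity) hξ0.le, Real.rpow_neg hξ0.le]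
  field_simp

theorem stmt_10 (a γ b : ℝ) (ha : 0 ≤ a) (hγ : 1 ≤ γ) (hγb : γ < b) (hb : b < 2 * γ) :
    ∃ C : ℝ, 0 < C ∧ ∀ f : SchwartzMap (EuclideanSpace ℝ (Fin 2)) ℂ,
      (∫ α : EuclideanSpace ℝ (Fin 2),
          (HsqNorm a (fun x => f x - f (x - α) - fderiv ℝ (⇑f) x α)) ^ γ *
            ‖α‖ ^ (-(2 + 2 * b))) ≤
        C * (HsqNorm (a + b / γ) ⇑f) ^ γ := by
  have hγ0 : 0 < γ := by linarith
  have hb0 : 0 < b := by linarith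
  set K : ℝ := (2 * Real.pi) ^ (2 * b) * ∫ β : Plane,
    (2 * ‖β‖ * min 1 ‖β‖) ^ (2 * γ) * ‖β‖ ^ (-(2 + 2 * b)) with hK
  have hK0 : 0 ≤ K := mul_nonneg (by positivity) (integral_nonneg fun β => by positivity)
  refine ⟨K + 1, by linarith, fun f => ?_⟩
  have hF : Continuous (𝓕 (⇑f)) := (𝓕 f).continuous
  set w : Plane → ENNReal := fun ξ =>
    ENNReal.ofReal (‖ξ‖ ^ (2 * (a + b / γ)) * ‖𝓕 (⇑f) ξ‖ ^ 2) with hw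
  set μ : Measure Plane := volume.withDensity w with hμ
  set h : Plane → Plane → ENNReal := fun α ξ => ENNReal.ofReal (‖ξ‖ ^ (-(2 * (b / γ))) *
    (2 * (2 * Real.pi * ‖ξ‖ * ‖α‖) * min 1 (2 * Real.pi * ‖ξ‖ * ‖α‖)) ^ 2) with hh
  set M := HsqNorm (a + b / γ) ⇑f with hM
  have hM0 : 0 ≤ M := HsqNorm_nonneg _ _
  have hμM : μ Set.univ = ENNReal.ofReal M := by
    rw [hμ, withDensity_apply _ .univ, Measure.restrict_univ]
    exact (ofReal_integral_eq_lintegral_ofReal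
      (integrable_norm_rpow_mul_norm_fourier_sq f (by positivity))
      (.of_forall fun ξ => by positivity)).symm
  have hN0 : ∀ α, 0 ≤ HsqNorm a (fun x => f x - f (x - α) - fderiv ℝ (⇑f) x α) :=
    fun α => HsqNorm_nonneg _ _
  have hR0 : 0 ≤ (K + 1) * M ^ γ := by positivity
  refine (le_abs_self _).trans ?_
  rw [← ENNReal.ofReal_le_ofReal_iff hR0, ← Real.enorm_eq_ofReal_abs]
  calc _ ≤ ∫⁻ α : Plane, ‖(HsqNorm a (fun x => f x - f (x - α) - fderiv ℝ (⇑f) x α)) ^ γ *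
            ‖α‖ ^ (-(2 + 2 * b))‖ₑ := enorm_integral_le_lintegral_enorm _
    _ ≤ ∫⁻ α : Plane, ENNReal.ofReal M ^ (γ - 1) *
          ∫⁻ ξ, h α ξ ^ γ * ENNReal.ofReal (‖α‖ ^ (-(2 + 2 * b))) ∂μ := by
        refine lintegral_mono fun α => ?_
        rw [enorm_mul, Real.enorm_of_nonneg (Real.rpow_nonneg (hN0 α) γ),
          ← ENNReal.ofReal_rpow_of_nonneg (hN0 α) hγ0.le, ← Real.enorm_of_nonneg (hN0 α),
          Real.enorm_of_nonneg (r := ‖α‖ ^ (-(2 + 2 * b))) (by positivity), lintegral_mul_const' _ _ ENNReal.ofReal_ne_top,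
          ← mul_assoc, mul_comm (_ ^ (γ - 1)), ← hμM]
        gcongr
        exact (ENNReal.rpow_le_rpow (enorm_HsqNorm_sub_translate_sub_fderiv_le f a (b / γ) α)
          hγ0.le).trans (lintegral_rpow_le_mul_measure_univ_rpow (by fun_prop) hγ)
    _ = ENNReal.ofReal M ^ (γ - 1) * ∫⁻ ξ, (∫⁻ α : Plane,
          h α ξ ^ γ * ENNReal.ofReal (‖α‖ ^ (-(2 + 2 * b)))) ∂μ := by
        rw [lintegral_const_mul' _ _
          (ENNReal.rpow_ne_top_of_nonneg (by linarith) ENNReal.ofReal_ne_top),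
          lintegral_lintegral_swap]
        simp only [hh, Function.uncurry_def]
        fun_prop
    _ ≤ ENNReal.ofReal M ^ (γ - 1) * ∫⁻ _, ENNReal.ofReal K ∂μ := by
        gcongr with ξ
        exact lintegral_weighted_kernel_le hγ0 hγb hb ξ
    _ = ENNReal.ofReal (K * M ^ γ) := by
        rw [lintegral_const, hμM, mul_left_comm,
          ENNReal.ofReal_rpow_of_nonneg hM0 (by linarith), ← ENNReal.ofReal_mul (by positivity),
          ← ENNReal.ofReal_mul hK0]
        congr 2
        rcases hM0.eq_or_lt with h0 | h0
        · rw [← h0, Real.zero_rpow hγ0.ne', mul_zero]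
        · rw [← Real.rpow_add_one h0.ne']; simp
    _ ≤ _ := by gcongr; linarith
end

section
/- Let κ be an admissible weight with φ defined by φ(λ) = 4π∫₀^∞ (1−cos r) r^{−5/2} κ(λ/r) dr, and fix s ∈ (0,2). Then there exist c, C > 0 such that for all Schwartz g on ℝ², c ∫ ||D|^s φ(|D|) g|² dx ≤ ∬_{ℝ²×ℝ²} |2g(x) − g(x+α) − g(x−α)|² (|α|^{−s} κ(1/|α|))² |α|^{−2} dx dα ≤ C ∫ ||D|^s φ(|D|) g|² dx. -/
open MeasureTheory FourierTransform

/-- The weight `φ` associated to an admissible weight `κ`. -/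
noncomputable def phiOf (κ : ℝ → ℝ) (lam : ℝ) : ℝ :=
  4 * Real.pi * ∫ r in Set.Ioi (0 : ℝ), (1 - Real.cos r) * r ^ (-(5 / 2) : ℝ) * κ (lam / r)

section SecondDifference

open Real Set

theorem weight_div_le {κ : ℝ → ℝ} (hκ1 : ∀ r : ℝ, 0 ≤ r → 1 ≤ κ r)
    (hlog : ∀ r s : ℝ, 0 ≤ r → r ≤ s →
      κ s / Real.log (4 + s) ≤ κ r / Real.log (4 + r))
    {ε lam r : ℝ} (hε : 0 < ε) (hlam : 0 ≤ lam) (hr : 0 < r) (hr1 : r ≤ 1) :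
    κ (lam / r) ≤ (1 + 1 / ε) * r ^ (-ε) * κ lam := by
  have hle : lam ≤ lam / r := le_div_self hlam hr hr1
  have hκ : 0 < κ lam := lt_of_lt_of_le one_pos (hκ1 lam hlam)
  have hL1 : 1 ≤ Real.log (4 + lam) := by
    rw [Real.le_log_iff_exp_le (by linarith)]
    linarith [Real.exp_one_lt_d9]
  have hL2 : 0 < Real.log (4 + lam / r) := Real.log_pos (by linarith)
  have h1 := hlog lam (lam / r) hlam hle
  rw [div_le_div_iff₀ hL2 (by linarith)] at h1
  have h2 : Real.log (4 + lam / r) ≤ Real.log (4 + lam) + r ^ (-ε) / ε := by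
    calc Real.log (4 + lam / r) ≤ Real.log ((4 + lam) * r⁻¹) := by
          apply Real.log_le_log (by linarith)
          have : 1 ≤ r⁻¹ := (one_le_inv₀ hr).2 hr1
          rw [add_mul, div_eq_mul_inv]
          linarith
      _ = Real.log (4 + lam) + Real.log r⁻¹ :=
          Real.log_mul (by linarith) (by positivity)
      _ ≤ _ := by
          have := Real.log_le_rpow_div (x := r⁻¹) (by positivity) hε
          rw [Real.inv_rpow hr.le, ← Real.rpow_neg hr.le] at this
          linarith
  have h3 : 1 ≤ r ^ (-ε) := Real.one_le_rpow_of_pos_of_le_one_of_nonpos hr hr1 (by linarith)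
  have h4 : Real.log (4 + lam / r) ≤ Real.log (4 + lam) * ((1 + 1 / ε) * r ^ (-ε)) := by
    calc _ ≤ Real.log (4 + lam) + r ^ (-ε) / ε := h2
      _ ≤ Real.log (4 + lam) * r ^ (-ε) + Real.log (4 + lam) * (r ^ (-ε) / ε) := by
          have : 0 ≤ r ^ (-ε) / ε := by positivity
          nlinarith
      _ = _ := by ring
  have h5 : κ (lam / r) * Real.log (4 + lam)
      ≤ ((1 + 1 / ε) * r ^ (-ε) * κ lam) * Real.log (4 + lam) := by
    refine h1.trans ?_
    nlinarith
  exact le_of_mul_le_mul_right h5 (by linarith)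

theorem integrableOn_Ioi_zero_of_rpow_bounds {f : ℝ → ℝ} (hf : Measurable f) {A B p q : ℝ}
    (hp : -1 < p) (hq : q < -1) (h0 : ∀ r, 0 < r → r ≤ 1 → |f r| ≤ A * r ^ p)
    (h1 : ∀ r, 1 < r → |f r| ≤ B * r ^ q) : IntegrableOn f (Ioi 0) := by
  rw [← Ioc_union_Ioi_eq_Ioi zero_le_one]
  refine IntegrableOn.union ?_ ?_
  · have hi : IntegrableOn (fun r : ℝ => A * r ^ p) (Ioc 0 1) := by
      rw [integrableOn_Ioc_iff_integrableOn_Ioo]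
      exact ((intervalIntegral.integrableOn_Ioo_rpow_iff one_pos).2 hp).const_mul A
    refine hi.mono' hf.aestronglyMeasurable ?_
    filter_upwards [ae_restrict_mem measurableSet_Ioc] with r hr using h0 r hr.1 hr.2
  · refine ((integrableOn_Ioi_rpow_of_lt hq one_pos).const_mul B).mono'
      hf.aestronglyMeasurable ?_
    filter_upwards [ae_restrict_mem measurableSet_Ioi] with r hr using h1 r hr

theorem phiOf_comparable {κ : ℝ → ℝ} (hmeas : Measurable κ)
    (hκ1 : ∀ r : ℝ, 0 ≤ r → 1 ≤ κ r)
    (hmono : ∀ r s : ℝ, 0 ≤ r → r ≤ s → κ r ≤ κ s)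
    (hlog : ∀ r s : ℝ, 0 ≤ r → r ≤ s →
      κ s / Real.log (4 + s) ≤ κ r / Real.log (4 + r)) :
    ∃ a b : ℝ, 0 < a ∧ 0 < b ∧ ∀ lam : ℝ, 0 ≤ lam →
      a * κ lam ≤ phiOf κ lam ∧ phiOf κ lam ≤ b * κ lam := by
  let F : ℝ → ℝ → ℝ := fun lam r => (1 - cos r) * r ^ (-(5 / 2) : ℝ) * κ (lam / r)
  let G : ℝ → ℝ := fun r => if r ≤ 1 then 5 * r ^ (-(3 / 4) : ℝ) else 2 * r ^ (-(5 / 2) : ℝ)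
  have hGm : Measurable G := by
    apply Measurable.ite measurableSet_Iic <;> fun_prop
  have hG : IntegrableOn G (Ioi 0) := by
    refine integrableOn_Ioi_zero_of_rpow_bounds hGm (A := 5) (B := 2) (p := -(3 / 4))
      (q := -(5 / 2)) (by norm_num) (by norm_num) (fun r hr hr1 => ?_) (fun r hr => ?_)
    · simp only [G, if_pos hr1]
      rw [abs_of_nonneg (by positivity)]
    · simp only [G, if_neg (not_le.2 hr)]
      rw [abs_of_nonneg (by positivity)]
  have hF0 : ∀ lam, 0 ≤ lam → ∀ r, 0 < r → 0 ≤ F lam r := fun lam hl r hr => by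
    have := hκ1 (lam / r) (by positivity)
    have := cos_le_one r
    have : 0 ≤ 1 - cos r := by linarith
    positivity
  have hFG : ∀ lam, 0 ≤ lam → ∀ r, 0 < r → F lam r ≤ G r * κ lam := fun lam hl r hr => by
    have hk := hκ1 lam hl
    by_cases hr1 : r ≤ 1
    · simp only [G, F, if_pos hr1]
      have h1 := weight_div_le hκ1 hlog (ε := 1 / 4) (by norm_num) hl hr hr1
      have h2 : 1 - cos r ≤ r ^ 2 := by
        have := one_sub_sq_div_two_le_cos (x := r)
        nlinarith [sq_nonneg r]
      have hk' := hκ1 (lam / r) (by positivity)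
      calc (1 - cos r) * r ^ (-(5 / 2) : ℝ) * κ (lam / r)
          ≤ r ^ 2 * r ^ (-(5 / 2) : ℝ) * ((1 + 1 / (1 / 4)) * r ^ (-(1 / 4) : ℝ) * κ lam) := by
            gcongr
        _ = 5 * (r ^ (2 : ℝ) * r ^ (-(5 / 2) : ℝ) * r ^ (-(1 / 4) : ℝ)) * κ lam := by
            rw [rpow_two]; ring
        _ = _ := by
            rw [← rpow_add hr, ← rpow_add hr]; norm_num
    · simp only [G, F, if_neg hr1]
      have h1 := hmono (lam / r) lam (by positivity) (div_le_self hl (not_le.1 hr1).le)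
      have h2 : 1 - cos r ≤ 2 := by linarith [neg_one_le_cos r]
      have hk' := hκ1 (lam / r) (by positivity)
      gcongr
  have hFi : ∀ lam, 0 ≤ lam → IntegrableOn (F lam) (Ioi 0) := fun lam hl => by
    refine (hG.mul_const (κ lam)).mono' (by fun_prop) ?_
    filter_upwards [ae_restrict_mem measurableSet_Ioi] with r hr
    rw [norm_of_nonneg (hF0 lam hl r hr)]
    exact hFG lam hl r hr
  have hG0 : 0 ≤ ∫ r in Ioi (0 : ℝ), G r := by
    refine setIntegral_nonneg measurableSet_Ioi fun r (hr : 0 < r) => ?_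
    simp only [G]
    split_ifs <;> positivity
  refine ⟨1 / π, 4 * π * ((∫ r in Ioi (0 : ℝ), G r) + 1), by positivity, by positivity,
    fun lam hl => ⟨?_, ?_⟩⟩
  · have hsub : ∫ r in Ioc (1 / 2 : ℝ) 1, F lam r ≤ ∫ r in Ioi (0 : ℝ), F lam r := by
      refine setIntegral_mono_set (hFi lam hl) ?_ ?_
      · filter_upwards [ae_restrict_mem measurableSet_Ioi] with r hr using hF0 lam hl r hr
      · exact LE.le.eventuallyLE fun r hr => lt_trans (by norm_num) hr.1
    have hlow : ∫ r in Ioc (1 / 2 : ℝ) 1, (1 / (2 * π ^ 2) * κ lam)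
        ≤ ∫ r in Ioc (1 / 2 : ℝ) 1, F lam r := by
      refine setIntegral_mono_on (integrableOn_const (by simp)) ((hFi lam hl).mono_set
        fun r hr => lt_trans (by norm_num) hr.1) measurableSet_Ioc fun r hr => ?_
      have hr0 : 0 < r := lt_trans (by norm_num) hr.1
      have h1 := hmono lam (lam / r) hl (le_div_self hl hr0 hr.2)
      have h2 : 1 ≤ r ^ (-(5 / 2) : ℝ) :=
        one_le_rpow_of_pos_of_le_one_of_nonpos hr0 hr.2 (by norm_num)
      have h3 : 1 / (2 * π ^ 2) ≤ 1 - cos r := by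
        have h := cos_le_one_sub_mul_cos_sq (x := r)
          (by rw [abs_of_pos hr0]; linarith [hr.2, pi_gt_three])
        have h5 : (1 / 2 : ℝ) ^ 2 ≤ r ^ 2 := pow_le_pow_left₀ (by norm_num) hr.1.le 2
        have h6 : 1 / (2 * π ^ 2) = 2 / π ^ 2 * (1 / 2 : ℝ) ^ 2 := by field_simp
        have h7 := mul_le_mul_of_nonneg_left h5 (by positivity : 0 ≤ 2 / π ^ 2)
        linarith
      have hk := hκ1 lam hl
      have h4 : 0 ≤ 1 - cos r := le_trans (by positivity) h3
      calc 1 / (2 * π ^ 2) * κ lam = 1 / (2 * π ^ 2) * 1 * κ lam := by ring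
        _ ≤ (1 - cos r) * r ^ (-(5 / 2) : ℝ) * κ (lam / r) := by gcongr
    rw [setIntegral_const] at hlow
    have hv : volume.real (Ioc (1 / 2 : ℝ) 1) = 1 / 2 := by
      simp [measureReal_def]; norm_num
    rw [hv, smul_eq_mul] at hlow
    have : 4 * π * (1 / 2 * (1 / (2 * π ^ 2) * κ lam)) ≤ phiOf κ lam := by
      unfold phiOf
      exact mul_le_mul_of_nonneg_left (hlow.trans hsub) (by positivity)
    refine le_trans (le_of_eq ?_) this
    field_simp
    norm_num
  · have hk := hκ1 lam hl
    have : ∫ r in Ioi (0 : ℝ), F lam r ≤ (∫ r in Ioi (0 : ℝ), G r) * κ lam := by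
      rw [← integral_mul_const]
      exact setIntegral_mono_on (hFi lam hl) (hG.mul_const _) measurableSet_Ioi
        fun r hr => hFG lam hl r hr
    unfold phiOf
    rw [mul_assoc (4 * π)]
    gcongr
    refine this.trans ?_
    gcongr
    linarith

local notation "Plane" => EuclideanSpace ℝ (Fin 2)

theorem integral_norm_sq_second_difference (g : SchwartzMap Plane ℂ) (α : Plane) :
    (Integrable fun ξ : Plane => (2 - 2 * cos (2 * π * inner ℝ α ξ)) ^ 2 * ‖𝓕 (g : Plane → ℂ) ξ‖ ^ 2) ∧
    ∫ x : Plane, ‖2 • g x - g (x + α) - g (x - α)‖ ^ 2 =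
      ∫ ξ : Plane, (2 - 2 * cos (2 * π * inner ℝ α ξ)) ^ 2 * ‖𝓕 (g : Plane → ℂ) ξ‖ ^ 2 := by
  let g₁ : SchwartzMap Plane ℂ := g.compSubConstCLM ℂ (-α)
  let g₂ : SchwartzMap Plane ℂ := g.compSubConstCLM ℂ α
  let d : SchwartzMap Plane ℂ := 2 • g - g₁ - g₂
  have hshift : ∀ (a ξ : Plane), 𝓕 (g.compSubConstCLM ℂ a) ξ
      = Complex.exp (↑(-(2 * π * inner ℝ a ξ)) * Complex.I) * 𝓕 g ξ := by
    intro a ξ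
    have h := congrFun (VectorFourier.fourierIntegral_comp_add_right 𝐞 volume (innerₗ Plane)
      (g : Plane → ℂ) (-a)) ξ
    rw [SchwartzMap.fourier_coe, SchwartzMap.fourier_coe]
    have h' : (⇑(g.compSubConstCLM ℂ a) : Plane → ℂ) = (g : Plane → ℂ) ∘ fun v => v + -a := by
      ext v; simp [sub_eq_add_neg]
    rw [h']
    refine h.trans ?_
    rw [Circle.smul_def, Real.fourierChar_apply, smul_eq_mul]
    simp [innerₗ_apply_apply]
    rfl
  have hd : ∀ ξ, 𝓕 d ξ = ((2 - 2 * cos (2 * π * inner ℝ α ξ) : ℝ) : ℂ) * 𝓕 g ξ := by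
    intro ξ
    have h0 : 𝓕 d = 2 • 𝓕 g - 𝓕 g₁ - 𝓕 g₂ := by
      simp only [d, ← FourierTransform.fourierCLM_apply (R := ℂ), map_sub, map_nsmul]
    rw [h0]
    simp only [sub_apply, smul_apply, g₁, g₂, hshift]
    rw [inner_neg_left]
    push_cast
    rw [Complex.cos, nsmul_eq_mul, mul_neg, neg_neg, Nat.cast_ofNat]
    ring
  have hn : ∀ ξ, ‖𝓕 d ξ‖ ^ 2
      = (2 - 2 * cos (2 * π * inner ℝ α ξ)) ^ 2 * ‖𝓕 (g : Plane → ℂ) ξ‖ ^ 2 := by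
    intro ξ
    rw [hd, norm_mul, mul_pow, Complex.norm_real, norm_eq_abs, sq_abs, SchwartzMap.fourier_coe]
  constructor
  · simp_rw [← hn]
    exact ((𝓕 d).memLp 2).integrable_norm_pow (by norm_num)
  · simp_rw [← hn]
    rw [SchwartzMap.integral_norm_sq_fourier]
    simp [d, g₁, g₂, sub_eq_add_neg]

theorem lintegral_kernel_le {κ : ℝ → ℝ}
    (hκ1 : ∀ r : ℝ, 0 ≤ r → 1 ≤ κ r)
    (hmono : ∀ r s : ℝ, 0 ≤ r → r ≤ s → κ r ≤ κ s)
    (hlog : ∀ r s : ℝ, 0 ≤ r → r ≤ s →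
      κ s / Real.log (4 + s) ≤ κ r / Real.log (4 + r))
    {s : ℝ} (hs0 : 0 < s) (hs2 : s < 2) :
    ∃ B : ℝ, 0 < B ∧ ∀ ξ : Plane, ξ ≠ 0 →
      ∫⁻ α : Plane, ENNReal.ofReal ((2 - 2 * cos (2 * π * inner ℝ α ξ)) ^ 2 *
        ((‖α‖ ^ (-s) * κ (1 / ‖α‖)) ^ 2 * ‖α‖ ^ (-(2 : ℝ))))
      ≤ ENNReal.ofReal (B * (‖ξ‖ ^ s * κ ‖ξ‖) ^ 2) := by
  let H : ℝ → ℝ := fun ρ => if ρ ≤ 1 then ρ ^ (-s) else ρ ^ (-(2 * s) - 2)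
  have hHm : Measurable H := by
    apply Measurable.ite measurableSet_Iic <;> fun_prop
  have hH0 : ∀ ρ, 0 ≤ ρ → 0 ≤ H ρ := fun ρ hρ => by
    simp only [H]
    split_ifs <;> positivity
  have hH : Integrable (fun x : Plane => H ‖x‖) := by
    rw [integrable_fun_norm_addHaar (volume : Measure Plane) (f := H)]
    simp only [finrank_euclideanSpace, Fintype.card_fin, Nat.add_one_sub_one, pow_one, smul_eq_mul]
    refine integrableOn_Ioi_zero_of_rpow_bounds (by fun_prop) (A := 1) (B := 1) (p := 1 - s)
      (q := -(2 * s) - 1) (by linarith) (by linarith) (fun r hr hr1 => ?_) (fun r hr => ?_)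
    · simp only [H, if_pos hr1]
      rw [abs_of_nonneg (by positivity), one_mul, sub_eq_add_neg, rpow_add hr, rpow_one]
    · have hr0 : 0 < r := one_pos.trans hr
      simp only [H, if_neg (not_le.2 hr)]
      rw [abs_of_nonneg (by positivity), one_mul,
        show -(2 * s) - 1 = 1 + (-(2 * s) - 2) by ring, rpow_add hr0, rpow_one]
  let ε : ℝ := (2 - s) / 2
  have hε : 0 < ε := by simp only [ε]; linarith
  let M : ℝ := (2 * π) ^ 4 * (1 + 1 / ε) ^ 2
  have hM1 : 1 ≤ (1 + 1 / ε) ^ 2 := by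
    have : 0 < 1 / ε := by positivity
    nlinarith
  have hM : 16 ≤ M := by
    have h1 : (2 : ℝ) ^ 4 ≤ (2 * π) ^ 4 :=
      pow_le_pow_left₀ (by norm_num) (by linarith [pi_gt_three]) 4
    simp only [M]
    nlinarith
  have key : ∀ ξ : Plane, ξ ≠ 0 → ∀ α : Plane, (2 - 2 * cos (2 * π * inner ℝ α ξ)) ^ 2 *
        ((‖α‖ ^ (-s) * κ (1 / ‖α‖)) ^ 2 * ‖α‖ ^ (-(2 : ℝ)))
      ≤ M * κ ‖ξ‖ ^ 2 * ‖ξ‖ ^ (2 * s + 2) * H ‖‖ξ‖ • α‖ := by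
    intro ξ hξ α
    have hx : 0 < ‖ξ‖ := norm_pos_iff.2 hξ
    rcases eq_or_ne α 0 with rfl | hα
    · have : (0 : ℝ) ^ (-s) = 0 := zero_rpow (by linarith)
      simp only [norm_zero, this]
      have := hH0 ‖‖ξ‖ • (0 : Plane)‖ (norm_nonneg _)
      have hMp : 0 ≤ M := by linarith
      simp only [zero_mul, ne_eq, OfNat.ofNat_ne_zero, not_false_eq_true, zero_pow, mul_zero]
      positivity
    have ha : 0 < ‖α‖ := norm_pos_iff.2 hα
    rw [norm_smul, norm_norm]
    set t := 2 * π * inner ℝ α ξ with ht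
    set ρ := ‖ξ‖ * ‖α‖ with hρdef
    have hρ : 0 < ρ := by positivity
    have hdiv : 1 / ‖α‖ = ‖ξ‖ / ρ := by rw [hρdef]; field_simp
    have hκξ := hκ1 ‖ξ‖ hx.le
    have hκα := hκ1 (1 / ‖α‖) (by positivity)
    have hpow : (‖α‖ ^ (-s)) ^ 2 * ‖α‖ ^ (-(2 : ℝ)) =
        ‖ξ‖ ^ (2 * s + 2) * ρ ^ (-(2 * s) - 2) := by
      rw [hρdef, mul_rpow hx.le ha.le, ← mul_assoc, ← rpow_add hx, ← rpow_natCast,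
        ← rpow_mul ha.le, ← rpow_add ha,
        show 2 * s + 2 + (-(2 * s) - 2) = 0 by ring, rpow_zero, one_mul]
      congr 1
      push_cast
      ring
    have hc0 : 0 ≤ 2 - 2 * cos t := by linarith [cos_le_one t]
    have hsplit : (2 - 2 * cos t) ^ 2 * ((‖α‖ ^ (-s) * κ (1 / ‖α‖)) ^ 2 * ‖α‖ ^ (-(2 : ℝ)))
        = (2 - 2 * cos t) ^ 2 * κ (1 / ‖α‖) ^ 2 * ρ ^ (-(2 * s) - 2) * ‖ξ‖ ^ (2 * s + 2) := by
      rw [mul_pow, mul_right_comm ((‖α‖ ^ (-s)) ^ 2), hpow]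
      ring
    rw [hsplit]
    have hmain : (2 - 2 * cos t) ^ 2 * κ (1 / ‖α‖) ^ 2 * ρ ^ (-(2 * s) - 2)
        ≤ M * κ ‖ξ‖ ^ 2 * H ρ := by
      by_cases hρ1 : ρ ≤ 1
      · simp only [H, if_pos hρ1]
        have h1 : κ (1 / ‖α‖) ≤ (1 + 1 / ε) * ρ ^ (-ε) * κ ‖ξ‖ := by
          rw [hdiv]
          exact weight_div_le hκ1 hlog hε hx.le hρ hρ1
        have h2 : 2 - 2 * cos t ≤ (2 * π) ^ 2 * ρ ^ 2 := by
          have h3 := one_sub_sq_div_two_le_cos (x := t)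
          have h4 : t ^ 2 ≤ (2 * π * ρ) ^ 2 := by
            apply sq_le_sq'
            · have := neg_le_of_abs_le (abs_real_inner_le_norm α ξ)
              rw [ht, hρdef]
              nlinarith [pi_pos]
            · have := le_of_abs_le (abs_real_inner_le_norm α ξ)
              rw [ht, hρdef]
              nlinarith [pi_pos]
          nlinarith
        calc (2 - 2 * cos t) ^ 2 * κ (1 / ‖α‖) ^ 2 * ρ ^ (-(2 * s) - 2)
            ≤ ((2 * π) ^ 2 * ρ ^ 2) ^ 2 * ((1 + 1 / ε) * ρ ^ (-ε) * κ ‖ξ‖) ^ 2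
              * ρ ^ (-(2 * s) - 2) := by gcongr
          _ = M * κ ‖ξ‖ ^ 2 * (ρ ^ (4 : ℝ) * ρ ^ (-ε * 2) * ρ ^ (-(2 * s) - 2)) := by
              rw [rpow_mul hρ.le, rpow_two, show (4 : ℝ) = (4 : ℕ) by norm_num, rpow_natCast]
              simp only [M]
              ring
          _ = _ := by
              rw [← rpow_add hρ, ← rpow_add hρ]
              congr 2
              simp only [ε]
              ring
      · simp only [H, if_neg hρ1]
        have h1 : κ (1 / ‖α‖) ≤ κ ‖ξ‖ := by
          rw [hdiv]
          exact hmono _ _ (by positivity) (div_le_self hx.le (not_le.1 hρ1).le)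
        have h2 : 2 - 2 * cos t ≤ 4 := by linarith [neg_one_le_cos t]
        calc (2 - 2 * cos t) ^ 2 * κ (1 / ‖α‖) ^ 2 * ρ ^ (-(2 * s) - 2)
            ≤ 4 ^ 2 * κ ‖ξ‖ ^ 2 * ρ ^ (-(2 * s) - 2) := by gcongr
          _ ≤ _ := by gcongr; linarith
    calc _ ≤ M * κ ‖ξ‖ ^ 2 * H ρ * ‖ξ‖ ^ (2 * s + 2) := by gcongr
      _ = _ := by ring
  have hI0 : 0 ≤ ∫ x : Plane, H ‖x‖ := integral_nonneg fun x => hH0 _ (norm_nonneg _)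
  refine ⟨M * ((∫ x : Plane, H ‖x‖) + 1), by positivity, fun ξ hξ => ?_⟩
  have hx : 0 < ‖ξ‖ := norm_pos_iff.2 hξ
  have hMp : 0 ≤ M := by linarith
  refine (lintegral_mono fun α => ENNReal.ofReal_le_ofReal (key ξ hξ α)).trans ?_
  rw [← ofReal_integral_eq_lintegral_ofReal]
  · apply ENNReal.ofReal_le_ofReal
    rw [integral_const_mul, Measure.integral_comp_smul_of_nonneg volume (fun x : Plane => H ‖x‖)
      ‖ξ‖ (hR := hx.le), finrank_euclideanSpace, Fintype.card_fin, smul_eq_mul, rpow_add hx,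
      mul_comm 2 s, rpow_mul hx.le, rpow_two, rpow_two]
    calc _ = M * (∫ x : Plane, H ‖x‖) * (‖ξ‖ ^ s * κ ‖ξ‖) ^ 2 := by field_simp
      _ ≤ _ := by gcongr; linarith
  · exact (hH.comp_smul hx.ne').const_mul _
  · filter_upwards with α
    have := hH0 ‖‖ξ‖ • α‖ (norm_nonneg _)
    positivity

theorem le_lintegral_kernel {κ : ℝ → ℝ}
    (hκ1 : ∀ r : ℝ, 0 ≤ r → 1 ≤ κ r)
    (hmono : ∀ r s : ℝ, 0 ≤ r → r ≤ s → κ r ≤ κ s)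
    {s : ℝ} (hs0 : 0 < s) :
    ∃ A : ℝ, 0 < A ∧ ∀ ξ : Plane, ξ ≠ 0 →
      ENNReal.ofReal (A * (‖ξ‖ ^ s * κ ‖ξ‖) ^ 2) ≤
      ∫⁻ α : Plane, ENNReal.ofReal ((2 - 2 * cos (2 * π * inner ℝ α ξ)) ^ 2 *
        ((‖α‖ ^ (-s) * κ (1 / ‖α‖)) ^ 2 * ‖α‖ ^ (-(2 : ℝ)))) := by
  let v : ℝ := volume.real (Metric.ball (0 : Plane) 1)
  have hv : 0 < v := by
    simp only [v, measureReal_def]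
    exact ENNReal.toReal_pos (Metric.measure_ball_pos _ _ one_pos).ne' measure_ball_lt_top.ne
  refine ⟨1 / 16 * (v / 64), by positivity, fun ξ hξ => ?_⟩
  have hx : 0 < ‖ξ‖ := norm_pos_iff.2 hξ
  have hκξ := hκ1 ‖ξ‖ hx.le
  let α₀ : Plane := (1 / (4 * ‖ξ‖ ^ 2)) • ξ
  let R : ℝ := 1 / (8 * ‖ξ‖)
  have hR : 0 < R := by positivity
  have hα₀ : inner ℝ α₀ ξ = (1 / 4 : ℝ) := by
    simp only [α₀, real_inner_smul_left, real_inner_self_eq_norm_sq]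
    field_simp
  have hα₀n : ‖α₀‖ = 1 / (4 * ‖ξ‖) := by
    simp only [α₀, norm_smul]
    rw [norm_of_nonneg (by positivity)]
    field_simp
  have key : ∀ α ∈ Metric.ball α₀ R, 1 / 16 * (‖ξ‖ ^ s * κ ‖ξ‖) ^ 2 * ‖ξ‖ ^ 2 ≤
      (2 - 2 * cos (2 * π * inner ℝ α ξ)) ^ 2 *
        ((‖α‖ ^ (-s) * κ (1 / ‖α‖)) ^ 2 * ‖α‖ ^ (-(2 : ℝ))) := by
    intro α hα
    rw [Metric.mem_ball, dist_eq_norm] at hα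
    have hin : |inner ℝ α ξ - 1 / 4| ≤ (1 / 8 : ℝ) := by
      rw [← hα₀, ← inner_sub_left]
      refine (abs_real_inner_le_norm _ _).trans ?_
      calc ‖α - α₀‖ * ‖ξ‖ ≤ R * ‖ξ‖ := by gcongr
        _ = 1 / 8 := by simp only [R]; field_simp
    rw [abs_le] at hin
    have hα0 : α ≠ 0 := by
      rintro rfl
      rw [inner_zero_left] at hin
      linarith [hin.1]
    have ha : 0 < ‖α‖ := norm_pos_iff.2 hα0
    have han : ‖ξ‖ ≤ 1 / ‖α‖ := by
      rw [le_div_iff₀ ha]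
      have h1 : ‖α‖ ≤ R + 1 / (4 * ‖ξ‖) := by
        calc ‖α‖ = ‖(α - α₀) + α₀‖ := by rw [sub_add_cancel]
          _ ≤ _ := (norm_add_le _ _).trans (by rw [hα₀n]; gcongr)
      calc ‖ξ‖ * ‖α‖ ≤ ‖ξ‖ * (R + 1 / (4 * ‖ξ‖)) := by gcongr
        _ = 3 / 8 := by simp only [R]; field_simp; norm_num
        _ ≤ 1 := by norm_num
    have hcos : 1 / 4 ≤ 2 - 2 * cos (2 * π * inner ℝ α ξ) := by
      have h := cos_le_one_sub_mul_cos_sq (x := 2 * π * inner ℝ α ξ) (by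
        rw [abs_le]; constructor <;> nlinarith [pi_pos])
      have h2 : 2 / π ^ 2 * (2 * π * inner ℝ α ξ) ^ 2 = 8 * (inner ℝ α ξ : ℝ) ^ 2 := by
        field_simp
        ring
      have h3 : (1 / 8 : ℝ) ^ 2 ≤ (inner ℝ α ξ : ℝ) ^ 2 :=
        pow_le_pow_left₀ (by norm_num) (by linarith) 2
      rw [h2] at h
      linarith
    have hk : κ ‖ξ‖ ≤ κ (1 / ‖α‖) := hmono _ _ hx.le han
    have hp : ‖ξ‖ ^ s ≤ ‖α‖ ^ (-s) := by
      rw [rpow_neg ha.le, ← inv_rpow ha.le, ← one_div]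
      exact rpow_le_rpow hx.le han hs0.le
    have hp2 : ‖ξ‖ ^ 2 ≤ ‖α‖ ^ (-(2 : ℝ)) := by
      rw [rpow_neg ha.le, ← inv_rpow ha.le, ← one_div, rpow_two]
      exact pow_le_pow_left₀ hx.le han 2
    calc 1 / 16 * (‖ξ‖ ^ s * κ ‖ξ‖) ^ 2 * ‖ξ‖ ^ 2
        = (1 / 4) ^ 2 * ((‖ξ‖ ^ s * κ ‖ξ‖) ^ 2 * ‖ξ‖ ^ 2) := by ring
      _ ≤ _ := by gcongr
  calc ENNReal.ofReal (1 / 16 * (v / 64) * (‖ξ‖ ^ s * κ ‖ξ‖) ^ 2)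
      = ENNReal.ofReal (1 / 16 * (‖ξ‖ ^ s * κ ‖ξ‖) ^ 2 * ‖ξ‖ ^ 2)
        * volume (Metric.ball α₀ R) := by
        rw [Measure.addHaar_ball _ _ hR.le, finrank_euclideanSpace, Fintype.card_fin,
          ← ofReal_measureReal measure_ball_lt_top.ne, ← ENNReal.ofReal_mul (by positivity),
          ← ENNReal.ofReal_mul (by positivity)]
        congr 1
        simp only [R, v]
        field_simp
        norm_num
    _ = ∫⁻ α in Metric.ball α₀ R,
          ENNReal.ofReal (1 / 16 * (‖ξ‖ ^ s * κ ‖ξ‖) ^ 2 * ‖ξ‖ ^ 2) := by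
        rw [setLIntegral_const]
    _ ≤ ∫⁻ α in Metric.ball α₀ R, ENNReal.ofReal ((2 - 2 * cos (2 * π * inner ℝ α ξ)) ^ 2 *
        ((‖α‖ ^ (-s) * κ (1 / ‖α‖)) ^ 2 * ‖α‖ ^ (-(2 : ℝ)))) :=
        setLIntegral_mono' measurableSet_ball fun α hα => ENNReal.ofReal_le_ofReal (key α hα)
    _ ≤ _ := setLIntegral_le_lintegral _ _

theorem measurable_phiOf {κ : ℝ → ℝ} (hmeas : Measurable κ) : Measurable (phiOf κ) := by
  have h : StronglyMeasurable (Function.uncurry fun lam r : ℝ =>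
      (1 - cos r) * r ^ (-(5 / 2) : ℝ) * κ (lam / r)) :=
    Measurable.stronglyMeasurable (by unfold Function.uncurry; fun_prop)
  exact (h.integral_prod_right (ν := volume.restrict (Ioi 0))).measurable.const_mul _

theorem toReal_lintegral_comparable {X : Type*} [MeasurableSpace X] {μ : Measure X}
    {F G : X → ENNReal} {c C : ℝ} (hc : 0 < c) (hC : 0 < C)
    (h1 : ∀ᵐ x ∂μ, ENNReal.ofReal c * F x ≤ G x) (h2 : ∀ᵐ x ∂μ, G x ≤ ENNReal.ofReal C * F x) :
    c * (∫⁻ x, F x ∂μ).toReal ≤ (∫⁻ x, G x ∂μ).toReal ∧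
      (∫⁻ x, G x ∂μ).toReal ≤ C * (∫⁻ x, F x ∂μ).toReal := by
  have h1' : ENNReal.ofReal c * ∫⁻ x, F x ∂μ ≤ ∫⁻ x, G x ∂μ := by
    rw [← lintegral_const_mul' _ _ ENNReal.ofReal_ne_top]
    exact lintegral_mono_ae h1
  have h2' : ∫⁻ x, G x ∂μ ≤ ENNReal.ofReal C * ∫⁻ x, F x ∂μ := by
    rw [← lintegral_const_mul' _ _ ENNReal.ofReal_ne_top]
    exact lintegral_mono_ae h2
  by_cases hF : ∫⁻ x, F x ∂μ = ⊤
  · have hG : ∫⁻ x, G x ∂μ = ⊤ := by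
      rw [hF, ENNReal.mul_top (by simpa using hc)] at h1'
      exact top_le_iff.1 h1'
    simp [hF, hG]
  · have hCF : ENNReal.ofReal C * ∫⁻ x, F x ∂μ ≠ ⊤ := ENNReal.mul_ne_top ENNReal.ofReal_ne_top hF
    have hG : ∫⁻ x, G x ∂μ ≠ ⊤ := ne_top_of_le_ne_top hCF h2'
    have e1 := ENNReal.toReal_mono hG h1'
    have e2 := ENNReal.toReal_mono hCF h2'
    rw [ENNReal.toReal_mul, ENNReal.toReal_ofReal hc.le] at e1
    rw [ENNReal.toReal_mul, ENNReal.toReal_ofReal hC.le] at e2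
    exact ⟨e1, e2⟩

theorem integral_second_difference_eq_toReal_lintegral (g : SchwartzMap Plane ℂ) {W : Plane → ℝ}
    (hW : Measurable W) (hW0 : ∀ α, 0 ≤ W α) :
    ∫ α : Plane, ∫ x : Plane, ‖2 • g x - g (x + α) - g (x - α)‖ ^ 2 * W α =
      (∫⁻ ξ : Plane, ENNReal.ofReal (‖𝓕 (g : Plane → ℂ) ξ‖ ^ 2) *
        ∫⁻ α : Plane, ENNReal.ofReal ((2 - 2 * cos (2 * π * inner ℝ α ξ)) ^ 2 * W α)).toReal := by
  have hgc : Continuous fun ξ => 𝓕 (g : Plane → ℂ) ξ := by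
    rw [← SchwartzMap.fourier_coe]
    exact (𝓕 g).continuous
  have hgm : Measurable fun ξ => 𝓕 (g : Plane → ℂ) ξ := hgc.measurable
  let f : Plane → Plane → ℝ := fun α ξ =>
    (2 - 2 * cos (2 * π * inner ℝ α ξ)) ^ 2 * ‖𝓕 (g : Plane → ℂ) ξ‖ ^ 2 * W α
  have hfm : Measurable (Function.uncurry f) := by
    unfold Function.uncurry
    simp only [f]
    have : Measurable fun p : Plane × Plane => (inner ℝ p.1 p.2 : ℝ) := continuous_inner.measurable
    fun_prop
  have hf0 : ∀ α ξ, 0 ≤ f α ξ := fun α ξ => mul_nonneg (by positivity) (hW0 α)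
  have hinner : ∀ α : Plane, ∫ x : Plane, ‖2 • g x - g (x + α) - g (x - α)‖ ^ 2 * W α = ∫ ξ, f α ξ := by
    intro α
    simp only [f]
    rw [integral_mul_const, integral_mul_const, (integral_norm_sq_second_difference g α).2]
  simp_rw [hinner]
  rw [integral_eq_lintegral_of_nonneg_ae
    (Filter.Eventually.of_forall fun α => integral_nonneg (hf0 α))
    hfm.stronglyMeasurable.integral_prod_right.aestronglyMeasurable]
  congr 1
  calc ∫⁻ α, ENNReal.ofReal (∫ ξ, f α ξ) = ∫⁻ α, ∫⁻ ξ, ENNReal.ofReal (f α ξ) := by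
        refine lintegral_congr fun α => ofReal_integral_eq_lintegral_ofReal ?_
          (Filter.Eventually.of_forall (hf0 α))
        exact (integral_norm_sq_second_difference g α).1.mul_const _
    _ = ∫⁻ ξ, ∫⁻ α, ENNReal.ofReal (f α ξ) :=
        lintegral_lintegral_swap hfm.ennreal_ofReal.aemeasurable
    _ = _ := by
        refine lintegral_congr fun ξ => ?_
        rw [← lintegral_const_mul' _ _ ENNReal.ofReal_ne_top]
        refine lintegral_congr fun α => ?_
        rw [← ENNReal.ofReal_mul (by positivity)]
        congr 1
        simp only [f]
        ring

theorem second_difference_comparable {κ : ℝ → ℝ} (hmeas : Measurable κ)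
    (hκ1 : ∀ r : ℝ, 0 ≤ r → 1 ≤ κ r)
    (hmono : ∀ r s : ℝ, 0 ≤ r → r ≤ s → κ r ≤ κ s)
    (hlog : ∀ r s : ℝ, 0 ≤ r → r ≤ s →
      κ s / Real.log (4 + s) ≤ κ r / Real.log (4 + r))
    {s : ℝ} (hs0 : 0 < s) (hs2 : s < 2) :
    ∃ c C : ℝ, 0 < c ∧ 0 < C ∧ ∀ g : SchwartzMap Plane ℂ,
      (c * ∫ ξ : Plane, (‖ξ‖ ^ s * phiOf κ ‖ξ‖) ^ 2 * ‖𝓕 ⇑g ξ‖ ^ 2 ≤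
          ∫ α : Plane, ∫ x : Plane,
            ‖2 • g x - g (x + α) - g (x - α)‖ ^ 2 * (‖α‖ ^ (-s) * κ (1 / ‖α‖)) ^ 2 *
              ‖α‖ ^ (-(2 : ℝ))) ∧
        (∫ α : Plane, ∫ x : Plane,
            ‖2 • g x - g (x + α) - g (x - α)‖ ^ 2 * (‖α‖ ^ (-s) * κ (1 / ‖α‖)) ^ 2 *
              ‖α‖ ^ (-(2 : ℝ))) ≤
          C * ∫ ξ : Plane, (‖ξ‖ ^ s * phiOf κ ‖ξ‖) ^ 2 * ‖𝓕 ⇑g ξ‖ ^ 2 := by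
  obtain ⟨a, b, ha, hb, hab⟩ := phiOf_comparable hmeas hκ1 hmono hlog
  obtain ⟨A, hA, hlow⟩ := le_lintegral_kernel hκ1 hmono hs0
  obtain ⟨B, hB, hupp⟩ := lintegral_kernel_le hκ1 hmono hlog hs0 hs2
  have hφm := measurable_phiOf hmeas
  refine ⟨A / b ^ 2, B / a ^ 2, by positivity, by positivity, fun g => ?_⟩
  have hgm : Measurable fun ξ => 𝓕 (g : Plane → ℂ) ξ := by
    rw [← SchwartzMap.fourier_coe]
    exact (𝓕 g).continuous.measurable
  simp_rw [mul_assoc (‖_‖ ^ 2 : ℝ)]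
  rw [integral_second_difference_eq_toReal_lintegral g
      (W := fun α => (‖α‖ ^ (-s) * κ (1 / ‖α‖)) ^ 2 * ‖α‖ ^ (-(2 : ℝ)))
      (by fun_prop) (fun α => by positivity),
    integral_eq_lintegral_of_nonneg_ae (Filter.Eventually.of_forall fun ξ => by positivity)
      (by fun_prop)]
  have hne : ∀ᵐ ξ : Plane, ξ ≠ 0 := by
    simp [ae_iff]
  apply toReal_lintegral_comparable (by positivity) (by positivity)
  · filter_upwards [hne] with ξ hξ
    have hk := hκ1 ‖ξ‖ (norm_nonneg _)
    have hφ := hab ‖ξ‖ (norm_nonneg _)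
    have hφ0 : 0 ≤ phiOf κ ‖ξ‖ := le_trans (by positivity) hφ.1
    rw [mul_comm ((‖ξ‖ ^ s * phiOf κ ‖ξ‖) ^ 2), ENNReal.ofReal_mul (by positivity),
      mul_left_comm]
    gcongr
    rw [← ENNReal.ofReal_mul (by positivity)]
    refine le_trans (ENNReal.ofReal_le_ofReal ?_) (hlow ξ hξ)
    calc A / b ^ 2 * (‖ξ‖ ^ s * phiOf κ ‖ξ‖) ^ 2
        ≤ A / b ^ 2 * (‖ξ‖ ^ s * (b * κ ‖ξ‖)) ^ 2 := by gcongr; exact hφ.2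
      _ = _ := by field_simp
  · filter_upwards [hne] with ξ hξ
    have hk := hκ1 ‖ξ‖ (norm_nonneg _)
    have hφ := hab ‖ξ‖ (norm_nonneg _)
    rw [mul_comm ((‖ξ‖ ^ s * phiOf κ ‖ξ‖) ^ 2), ENNReal.ofReal_mul (by positivity),
      mul_left_comm]
    gcongr
    rw [← ENNReal.ofReal_mul (by positivity)]
    refine (hupp ξ hξ).trans (ENNReal.ofReal_le_ofReal ?_)
    calc B * (‖ξ‖ ^ s * κ ‖ξ‖) ^ 2 = B / a ^ 2 * (‖ξ‖ ^ s * (a * κ ‖ξ‖)) ^ 2 := by field_simp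
      _ ≤ _ := by gcongr; exact hφ.1

end SecondDifference

theorem stmt_14 (κ : ℝ → ℝ) (c₀ : ℝ)
    (hκ1 : ∀ r : ℝ, 0 ≤ r → 1 ≤ κ r)
    (hmono : ∀ r s : ℝ, 0 ≤ r → r ≤ s → κ r ≤ κ s)
    (hdbl : ∀ r : ℝ, 0 ≤ r → κ (2 * r) ≤ c₀ * κ r)
    (hlog : ∀ r s : ℝ, 0 ≤ r → r ≤ s →
      κ s / Real.log (4 + s) ≤ κ r / Real.log (4 + r))
    (s : ℝ) (hs0 : 0 < s) (hs2 : s < 2) :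
    ∃ c C : ℝ, 0 < c ∧ 0 < C ∧ ∀ g : SchwartzMap (EuclideanSpace ℝ (Fin 2)) ℂ,
      (c * ∫ ξ : EuclideanSpace ℝ (Fin 2),
            (‖ξ‖ ^ s * phiOf κ ‖ξ‖) ^ 2 * ‖𝓕 ⇑g ξ‖ ^ 2 ≤
          ∫ α : EuclideanSpace ℝ (Fin 2), ∫ x : EuclideanSpace ℝ (Fin 2),
            ‖2 • g x - g (x + α) - g (x - α)‖ ^ 2 * (‖α‖ ^ (-s) * κ (1 / ‖α‖)) ^ 2 *
              ‖α‖ ^ (-(2 : ℝ))) ∧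
        (∫ α : EuclideanSpace ℝ (Fin 2), ∫ x : EuclideanSpace ℝ (Fin 2),
            ‖2 • g x - g (x + α) - g (x - α)‖ ^ 2 * (‖α‖ ^ (-s) * κ (1 / ‖α‖)) ^ 2 *
              ‖α‖ ^ (-(2 : ℝ))) ≤
          C * ∫ ξ : EuclideanSpace ℝ (Fin 2),
            (‖ξ‖ ^ s * phiOf κ ‖ξ‖) ^ 2 * ‖𝓕 ⇑g ξ‖ ^ 2 := by
  let κ' : ℝ → ℝ := fun r => κ (max r 0)
  have heq : ∀ r, 0 ≤ r → κ' r = κ r := fun r hr => by simp only [κ', max_eq_left hr]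
  have hmeas : Measurable κ' :=
    Monotone.measurable fun r t hrt => hmono _ _ (le_max_right _ _) (max_le_max_right 0 hrt)
  have hφ : ∀ lam, 0 ≤ lam → phiOf κ' lam = phiOf κ lam := fun lam hl => by
    unfold phiOf
    congr 1
    refine setIntegral_congr_fun measurableSet_Ioi fun r (hr : 0 < r) => ?_
    simp only [heq (lam / r) (by positivity)]
  obtain ⟨c, C, hc, hC, h⟩ := second_difference_comparable hmeas
    (fun r hr => by rw [heq r hr]; exact hκ1 r hr)
    (fun r t hr hrt => by rw [heq r hr, heq t (hr.trans hrt)]; exact hmono r t hr hrt)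
    (fun r t hr hrt => by rw [heq r hr, heq t (hr.trans hrt)]; exact hlog r t hr hrt) hs0 hs2
  refine ⟨c, C, hc, hC, fun g => ?_⟩
  simpa only [hφ _ (norm_nonneg _), heq _ (one_div_nonneg.2 (norm_nonneg _))] using h g
end
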